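/- Let φ ∈ L_BAPAL(P) with p an atom occurring in φ, and let M be an epistemic model for atoms P with state s. If φ is valid, then M̈_s ⊨ φ[q/p] for any q ∈ P̈∖P, where φ[q/p] is the result of substituting q for every occurrence of p in φ. -/

import Mathlib

/-- Boolean (propositional) formulas over atoms `P`. -/
inductive PLForm (P : Type) : Type
  | atom : P → PLForm P
  | neg : PLForm P → PLForm P
  | and : PLForm P → PLForm P → PLForm P

/-- The language L_BAPAL over agents `A` and atoms `P`. -/
inductive Form (A P : Type) : Type
  | atom : P → Form A P
  | neg : Form A P → Form A P
  | and : Form A P → Form A P → Form A P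
  | know : A → Form A P → Form A P
  | ann : Form A P → Form A P → Form A P
  | box : Form A P → Form A P

def PLForm.toForm {A P : Type} : PLForm P → Form A P
  | .atom p => .atom p
  | .neg φ => .neg φ.toForm
  | .and φ ψ => .and φ.toForm ψ.toForm

structure Model (A P : Type) where
  S : Type
  rel : A → S → S → Prop
  val : P → S → Prop

/-- An epistemic model: each accessibility relation is an equivalence relation. -/
def Model.IsEpistemic {A P : Type} (M : Model A P) : Prop :=
  ∀ a : A, Equivalence (M.rel a)

/-- Restriction of a model to a subset of its states. -/
def Model.restrict {A P : Type} (M : Model A P) (X : Set M.S) : Model A P where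
  S := X
  rel a s t := M.rel a s.val t.val
  val p s := M.val p s.val

/-- Satisfaction of boolean formulas. -/
def SatPL {A P : Type} (M : Model A P) (s : M.S) : PLForm P → Prop
  | .atom p => M.val p s
  | .neg φ => ¬ SatPL M s φ
  | .and φ ψ => SatPL M s φ ∧ SatPL M s ψ

/-- BAPAL satisfaction. -/
def Sat {A P : Type} : (M : Model A P) → M.S → Form A P → Prop
  | M, s, .atom p => M.val p s
  | M, s, .neg φ => ¬ Sat M s φ
  | M, s, .and φ ψ => Sat M s φ ∧ Sat M s ψ
  | M, s, .know a φ => ∀ t : M.S, M.rel a s t → Sat M t φ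
  | M, s, .ann φ ψ => ∀ h : Sat M s φ, Sat (M.restrict {t | Sat M t φ}) ⟨s, h⟩ ψ
  | M, s, .box ψ => ∀ (φ₀ : PLForm P) (h : SatPL M s φ₀),
      Sat (M.restrict {t | SatPL M t φ₀}) ⟨s, h⟩ ψ

def Valid {A P : Type} (φ : Form A P) : Prop :=
  ∀ M : Model A P, M.IsEpistemic → ∀ s : M.S, Sat M s φ

def Form.imp {A P : Type} (φ ψ : Form A P) : Form A P := .neg (.and φ (.neg ψ))
def Form.iff {A P : Type} (φ ψ : Form A P) : Form A P := .and (φ.imp ψ) (ψ.imp φ)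
def Form.dia {A P : Type} (φ : Form A P) : Form A P := .neg (.box (.neg φ))
def Form.khat {A P : Type} (a : A) (φ : Form A P) : Form A P := .neg (.know a (.neg φ))
def Form.diaAnn {A P : Type} (φ ψ : Form A P) : Form A P := .neg (.ann φ (.neg ψ))

def Form.occurs {A P : Type} (q : P) : Form A P → Prop
  | .atom p => p = q
  | .neg φ => φ.occurs q
  | .and φ ψ => φ.occurs q ∨ ψ.occurs q
  | .know _ φ => φ.occurs q
  | .ann φ ψ => φ.occurs q ∨ ψ.occurs q
  | .box φ => φ.occurs q

def Form.mapAtoms {A P Q : Type} (f : P → Q) : Form A P → Form A Q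
  | .atom p => .atom (f p)
  | .neg φ => .neg (φ.mapAtoms f)
  | .and φ ψ => .and (φ.mapAtoms f) (ψ.mapAtoms f)
  | .know a φ => .know a (φ.mapAtoms f)
  | .ann φ ψ => .ann (φ.mapAtoms f) (ψ.mapAtoms f)
  | .box φ => .box (φ.mapAtoms f)

/-- The extended atom set `P̈ = P ∪ {p_{φ₀} : φ₀ ∈ L_PL(P)}`: the right summand
provides a fresh atom `p_{φ₀}` for every boolean `φ₀` over `P`. -/
abbrev DDotAtoms (P : Type) : Type := P ⊕ PLForm P

/-- The boolean closure `M̈` of a model `M` for atoms `P`: same states and relations,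
and the fresh atom `p_{φ₀}` is assigned the value `⟦φ₀⟧_M`. -/
def Model.ddot {A P : Type} (M : Model A P) : Model A (DDotAtoms P) where
  S := M.S
  rel := M.rel
  val q s := match q with
    | .inl p => M.val p s
    | .inr φ₀ => SatPL M s φ₀

/-- Injective encoding of boolean formulas over `ℕ` as natural numbers. -/
def PLForm.toNat : PLForm ℕ → ℕ
  | .atom n => 3 * n
  | .neg φ => 3 * φ.toNat + 1
  | .and φ ψ => 3 * Nat.pair φ.toNat ψ.toNat + 2

theorem PLForm.toNat_injective : Function.Injective PLForm.toNat := by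
  intro φ
  induction φ with
  | atom n =>
    intro ψ h
    cases ψ <;> simp only [PLForm.toNat] at h
    · congr 1; omega
    · omega
    · omega
  | neg φ ih =>
    intro ψ h
    cases ψ <;> simp only [PLForm.toNat] at h
    · omega
    · congr 1; exact ih (by omega)
    · omega
  | and φ₁ φ₂ ih₁ ih₂ =>
    intro ψ h
    cases ψ <;> simp only [PLForm.toNat] at h
    · omega
    · omega
    · obtain ⟨h₁, h₂⟩ := Nat.pair_eq_pair.mp (Nat.eq_of_mul_eq_mul_left three_pos (Nat.add_right_cancel h))
      rw [ih₁ h₁, ih₂ h₂]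

instance : Countable (PLForm ℕ) := PLForm.toNat_injective.countable

def PLForm.mapAtoms {P Q : Type} (f : P → Q) : PLForm P → PLForm Q
  | .atom p => .atom (f p)
  | .neg φ => .neg (φ.mapAtoms f)
  | .and φ ψ => .and (φ.mapAtoms f) (ψ.mapAtoms f)

theorem PLForm.mapAtoms_surjective {P Q : Type} {f : P → Q} (hf : Function.Surjective f) :
    Function.Surjective (PLForm.mapAtoms f) := by
  intro φ
  induction φ with
  | atom q =>
    obtain ⟨p, rfl⟩ := hf q
    exact ⟨.atom p, rfl⟩
  | neg φ ih =>
    obtain ⟨φ, rfl⟩ := ih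
    exact ⟨.neg φ, rfl⟩
  | and φ ψ ihφ ihψ =>
    obtain ⟨φ, rfl⟩ := ihφ
    obtain ⟨ψ, rfl⟩ := ihψ
    exact ⟨.and φ ψ, rfl⟩

/-- The model for atoms `P` obtained from a model for atoms `Q` by reading `p` as `f p`. -/
def Model.comap {A P Q : Type} (f : P → Q) (M : Model A Q) : Model A P where
  S := M.S
  rel := M.rel
  val p := M.val (f p)

theorem satPL_comap {A P Q : Type} (f : P → Q) (M : Model A Q) (s : M.S) (φ : PLForm P) :
    SatPL (M.comap f) s φ ↔ SatPL M s (φ.mapAtoms f) := by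
  induction φ with
  | atom p => exact Iff.rfl
  | neg φ ih => exact not_congr ih
  | and φ ψ ihφ ihψ => exact and_congr ihφ ihψ

theorem forall_sat_restrict_comap_congr {A P Q : Type} {f : P → Q} {M : Model A Q} {X Y : Set M.S}
    (h : X = Y) {s : M.S} {φ : Form A P} {ψ : Form A Q}
    (H : ∀ hs : s ∈ Y, Sat ((M.restrict Y).comap f) ⟨s, hs⟩ φ ↔ Sat (M.restrict Y) ⟨s, hs⟩ ψ) :
    (∀ hs : s ∈ X, Sat ((M.comap f).restrict X) ⟨s, hs⟩ φ) ↔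
      ∀ hs : s ∈ Y, Sat (M.restrict Y) ⟨s, hs⟩ ψ := by
  subst h
  exact forall_congr' H

/-- Renaming atoms along a surjection is truth-preserving; surjectivity makes the two atom sets
define the same announcements in `□`. -/
theorem sat_comap {A P Q : Type} {f : P → Q} (hf : Function.Surjective f) (φ : Form A P)
    (M : Model A Q) (s : M.S) : Sat (M.comap f) s φ ↔ Sat M s (φ.mapAtoms f) := by
  induction φ generalizing M with
  | atom p => exact Iff.rfl
  | neg φ ih => exact not_congr (ih M s)
  | and φ ψ ihφ ihψ => exact and_congr (ihφ M s) (ihψ M s)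
  | know a φ ih => exact forall_congr' fun t => imp_congr Iff.rfl (ih M t)
  | ann φ ψ ihφ ihψ =>
    exact forall_sat_restrict_comap_congr (Set.ext fun t => ihφ M t)
      fun h => ihψ (M.restrict _) ⟨s, h⟩
  | box ψ ih =>
    have key (φ₀ : PLForm P) :
        (∀ h : SatPL (M.comap f) s φ₀,
          Sat ((M.comap f).restrict {t | SatPL (M.comap f) t φ₀}) ⟨s, h⟩ ψ) ↔
        ∀ h : SatPL M s (φ₀.mapAtoms f),
          Sat (M.restrict {t | SatPL M t (φ₀.mapAtoms f)}) ⟨s, h⟩ (ψ.mapAtoms f) :=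
      forall_sat_restrict_comap_congr (Set.ext fun t => satPL_comap f M t φ₀)
        fun h => ih (M.restrict _) ⟨s, h⟩
    refine (forall_congr' key).trans ((PLForm.mapAtoms_surjective hf).forall
      (p := fun χ => ∀ h : SatPL M s χ,
        Sat (M.restrict {t | SatPL M t χ}) ⟨s, h⟩ (ψ.mapAtoms f))).symm

theorem Form.mapAtoms_congr {A P Q : Type} {f g : P → Q} (φ : Form A P)
    (h : ∀ x, φ.occurs x → f x = g x) : φ.mapAtoms f = φ.mapAtoms g := by
  induction φ with
  | atom p => exact congrArg Form.atom (h p rfl)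
  | neg φ ih => exact congrArg Form.neg (ih h)
  | know a φ ih => exact congrArg (Form.know a) (ih h)
  | box φ ih => exact congrArg Form.box (ih h)
  | and φ ψ ihφ ihψ =>
    exact congrArg₂ Form.and (ihφ fun x hx => h x (.inl hx)) (ihψ fun x hx => h x (.inr hx))
  | ann φ ψ ihφ ihψ =>
    exact congrArg₂ Form.ann (ihφ fun x hx => h x (.inl hx)) (ihψ fun x hx => h x (.inr hx))

theorem Form.exists_occurs_lt {A : Type} (φ : Form A ℕ) : ∃ n, ∀ x, φ.occurs x → x < n := by
  induction φ with
  | atom p => exact ⟨p + 1, fun x (hx : p = x) => by omega⟩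
  | neg φ ih => exact ih
  | know a φ ih => exact ih
  | box φ ih => exact ih
  | and φ ψ ihφ ihψ | ann φ ψ ihφ ihψ =>
    obtain ⟨m, hm⟩ := ihφ
    obtain ⟨n, hn⟩ := ihψ
    exact ⟨max m n, fun x hx => hx.elim (fun h => lt_max_of_lt_left (hm x h))
      fun h => lt_max_of_lt_right (hn x h)⟩

/-- A map out of `ℕ` can be changed above any bound so as to become surjective. -/
theorem exists_surjective_eq_of_lt {Q : Type} [Countable Q] [Nonempty Q] (f : ℕ → Q) (n : ℕ) :
    ∃ g : ℕ → Q, Function.Surjective g ∧ ∀ x < n, f x = g x := by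
  obtain ⟨e, he⟩ := exists_surjective_nat Q
  refine ⟨fun x => if x < n then f x else e (x - n), fun y => ?_, fun x hx => (if_pos hx).symm⟩
  obtain ⟨k, rfl⟩ := he y
  exact ⟨k + n, by simp⟩

/-- if `φ ∈ L_BAPAL(P)` is valid and `p` occurs in `φ`, then for any
fresh atom `q ∈ P̈∖P`, the substitution `φ[q/p]` holds at every state of the boolean
closure `M̈` of any epistemic model `M` for atoms `P`. -/
theorem ddot_subst_valid {A : Type} [Countable A]
    (φ : Form A ℕ) (p : ℕ) (hp : φ.occurs p) (hval : Valid φ)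
    (M : Model A ℕ) (hM : M.IsEpistemic) (s : M.S) (q : PLForm ℕ) :
    Sat M.ddot s
      (φ.mapAtoms (fun x => if x = p then (Sum.inr q : DDotAtoms ℕ) else Sum.inl x)) := by
  obtain ⟨n, hn⟩ := φ.exists_occurs_lt
  obtain ⟨g, hg, hfg⟩ := exists_surjective_eq_of_lt
    (fun x => if x = p then (Sum.inr q : DDotAtoms ℕ) else Sum.inl x) n
  rw [φ.mapAtoms_congr fun x hx => hfg x (hn x hx)]
  refine (sat_comap hg φ M.ddot s).mp ?_
  exact hval (M.ddot.comap g) hM s
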